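/- Let n ≥ 2 and let f be a fixed-point-free involution of ZMod (2n) (a chord diagram with n chords). Suppose p, p+1, q, q+1 are four distinct points with f p = q + 1 and f (p+1) = q, so that c₁ = {p, q+1} and c₂ = {p+1, q} are two chords of f in the nested configuration of a second Reidemeister move. Then every chord of f other than c₁ and c₂ is linked with c₁ if and only if it is linked with c₂; consequently c₁ and c₂ have the same Gaussian parity. (This is the paper's parity axiom 2 for the Gaussian parity, for one of the two chord-diagram versions of the second Reidemeister move.) -/

import Mathlib

/-- `x` lies strictly between `a` and `b` in the cyclic order on `ZMod m`:
writing `b = a + j` with `j = (b - a).val`, `x = a + k` for some `1 ≤ k ≤ j - 1`. -/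
def inOpenArc {m : ℕ} (a b x : ZMod m) : Prop :=
  ∃ k : ℕ, 1 ≤ k ∧ k < (b - a).val ∧ x = a + (k : ZMod m)

/-- The pairs `{a, b}` and `{c, d}` are linked: exactly one of `c`, `d`
lies in the open arc from `a` to `b`. -/
def linked {m : ℕ} (a b c d : ZMod m) : Prop :=
  Xor' (inOpenArc a b c) (inOpenArc a b d)

/-- Linking of unordered pairs (given as two-element finsets). -/
def linkedPair {m : ℕ} (P Q : Finset (ZMod m)) : Prop :=
  ∃ a b c d : ZMod m, P = {a, b} ∧ Q = {c, d} ∧ linked a b c d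

/-- The chords of a chord diagram given by an involution `f` of `ZMod (2*n)`. -/
def chords {n : ℕ} (f : ZMod (2 * n) → ZMod (2 * n)) : Set (Finset (ZMod (2 * n))) :=
  {P | ∃ a, P = {a, f a}}

theorem arc_iff {m : ℕ} [NeZero m] (a b x : ZMod m) :
    inOpenArc a b x ↔ 0 < (x - a).val ∧ (x - a).val < (b - a).val := by
  constructor
  · rintro ⟨k, h1, h2, rfl⟩
    have : (a + (k : ZMod m) - a).val = k := by
      rw [add_sub_cancel_left, ZMod.val_cast_of_lt (h2.trans (ZMod.val_lt _))]
    omega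
  · rintro ⟨h1, h2⟩
    exact ⟨(x - a).val, h1, h2, by simp⟩

theorem val_step {m : ℕ} [NeZero m] (a x : ZMod m) (h : x + 1 ≠ a) :
    (x + 1 - a).val = (x - a).val + 1 := by
  have e : x + 1 - a = (((x - a).val + 1 : ℕ) : ZMod m) := by
    push_cast
    rw [ZMod.natCast_zmod_val]; ring
  have hlt := ZMod.val_lt (x - a)
  rw [e]
  apply ZMod.val_cast_of_lt
  rcases Nat.lt_or_ge ((x - a).val + 1) m with h' | h'
  · exact h'
  · exfalso
    have : (x - a).val + 1 = m := by omega
    rw [this, ZMod.natCast_self] at e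
    exact h (sub_eq_zero.1 e)

theorem val_pos' {m : ℕ} [NeZero m] (a x : ZMod m) (h : x ≠ a) : 0 < (x - a).val := by
  rw [ZMod.val_pos]; exact sub_ne_zero.2 h

theorem arc_step {m : ℕ} [NeZero m] (a b x : ZMod m) (ha : x ≠ a) (hb : x + 1 ≠ b)
    (ha' : x + 1 ≠ a) : x ≠ b → (inOpenArc a b x ↔ inOpenArc a b (x + 1)) := by
  intro _
  rw [arc_iff, arc_iff, val_step a x ha']
  have h1 := val_pos' a x ha
  have : (x - a).val + 1 ≠ (b - a).val := by
    rw [← val_step a x ha']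
    intro h
    exact hb (by simpa using ZMod.val_injective m h)
  omega

theorem arc_left {m : ℕ} [NeZero m] (a b : ZMod m) : ¬ inOpenArc a b a := by
  rw [arc_iff]; simp

theorem arc_right {m : ℕ} [NeZero m] (a b : ZMod m) : ¬ inOpenArc a b b := by
  rw [arc_iff]; simp

theorem linkedPair_iff {m : ℕ} (P : Finset (ZMod m)) (c d : ZMod m) :
    linkedPair P {c, d} ↔ ∃ a b, P = {a, b} ∧ linked a b c d := by
  constructor
  · rintro ⟨a, b, c', d', h1, h2, h3⟩
    refine ⟨a, b, h1, ?_⟩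
    have h2' : ({c, d} : Set (ZMod m)) = {c', d'} := by
      simpa using congrArg (fun s : Finset (ZMod m) => (s : Set (ZMod m))) h2
    rcases Set.pair_eq_pair_iff.1 h2' with ⟨rfl, rfl⟩ | ⟨rfl, rfl⟩
    · exact h3
    · exact Or.symm h3
  · rintro ⟨a, b, h1, h3⟩
    exact ⟨a, b, c, d, h1, rfl, h3⟩

theorem not_linked_self {m : ℕ} [NeZero m] (c d : ZMod m) :
    ¬ linkedPair ({c, d} : Finset (ZMod m)) {c, d} := by
  rw [linkedPair_iff]
  rintro ⟨a, b, h2, h3⟩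
  have h2' : ({c, d} : Set (ZMod m)) = {a, b} := by
    simpa using congrArg (fun s : Finset (ZMod m) => (s : Set (ZMod m))) h2
  rcases Set.pair_eq_pair_iff.1 h2' with ⟨rfl, rfl⟩ | ⟨rfl, rfl⟩ <;>
    rcases h3 with ⟨h, -⟩ | ⟨h, -⟩ <;> first | exact arc_left _ _ h | exact arc_right _ _ h

theorem not_linked_nested {m : ℕ} [NeZero m] (p q : ZMod m) (h1 : q + 1 ≠ p) (h2 : p + 1 ≠ q)
    (h3 : p ≠ q) (h4 : p + 1 ≠ p) :
    ¬ linkedPair ({p, q + 1} : Finset (ZMod m)) {p + 1, q} := by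
  rw [linkedPair_iff]
  rintro ⟨a, b, h, h'⟩
  have h2' : ({p, q + 1} : Set (ZMod m)) = {a, b} := by
    simpa using congrArg (fun s : Finset (ZMod m) => (s : Set (ZMod m))) h
  have e1 := val_step p q h1
  have e2 := val_step p p h4
  have e3 := val_pos' p q h3.symm
  have e4 : (p - p).val = 0 := by simp
  rcases Set.pair_eq_pair_iff.1 h2' with ⟨rfl, rfl⟩ | ⟨rfl, rfl⟩
  · unfold linked at h'
    rw [arc_iff, arc_iff] at h'
    rcases h' with ⟨_, _⟩ | ⟨_, _⟩ <;>
    omega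
  · have e5 := val_step (q + 1) p (by simpa using h3)
    have e6 : ¬ (q - (q + 1)).val < (p - (q + 1)).val := by
      have hq : (p - (q + 1)).val < m := ZMod.val_lt _
      have : (q - (q + 1)).val + 1 ≥ m := by
        by_contra hc
        have e : (((q - (q + 1)).val + 1 : ℕ) : ZMod m) = 0 := by
          push_cast
          rw [ZMod.natCast_zmod_val]; ring
        rw [ZMod.natCast_eq_zero_iff] at e
        have := Nat.le_of_dvd (by omega) e
        omega
      omega
    unfold linked at h'
    rw [arc_iff, arc_iff] at h'
    rcases h' with ⟨_, _⟩ | ⟨_, _⟩ <;>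
    omega

/-- Parity axiom 2, nested configuration: the two chords of a second
Reidemeister move have the same Gaussian parity. -/
theorem second_move_same_parity_nested (n : ℕ) (hn : 2 ≤ n)
    (f : ZMod (2 * n) → ZMod (2 * n)) (hinv : Function.Involutive f)
    (hfpf : ∀ x, f x ≠ x) (p q : ZMod (2 * n))
    (hdist : ({p, p + 1, q, q + 1} : Finset (ZMod (2 * n))).card = 4)
    (hp : f p = q + 1) (hp1 : f (p + 1) = q) :
    (∀ D ∈ chords f, D ≠ ({p, q + 1} : Finset (ZMod (2 * n))) →
      D ≠ ({p + 1, q} : Finset (ZMod (2 * n))) →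
      (linkedPair D ({p, q + 1} : Finset (ZMod (2 * n))) ↔
        linkedPair D ({p + 1, q} : Finset (ZMod (2 * n))))) ∧
    (Even (Set.ncard
        {D ∈ chords f | linkedPair D ({p, q + 1} : Finset (ZMod (2 * n)))}) ↔
      Even (Set.ncard
        {D ∈ chords f | linkedPair D ({p + 1, q} : Finset (ZMod (2 * n)))})) := by
  have : NeZero (2 * n) := ⟨by omega⟩
  have d1 : p ≠ p + 1 := by
    intro h; rw [← h] at hdist
    have := Finset.card_le_three (a := p) (b := q) (c := q + 1)
    simp at hdist; omega
  have d2 : p ≠ q := by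
    intro h; rw [← h] at hdist
    have := Finset.card_le_two (a := p) (b := p + 1)
    have e : ({p, p + 1, p, p + 1} : Finset (ZMod (2 * n))) = {p, p + 1} := by
      grind
    rw [e] at hdist; omega
  have d3 : q + 1 ≠ p := by
    intro h; rw [h] at hdist
    have := Finset.card_le_three (a := p) (b := p + 1) (c := q)
    have e : ({p, p + 1, q, p} : Finset (ZMod (2 * n))) = {p, p + 1, q} := by
      grind
    rw [e] at hdist; omega
  have d4 : p + 1 ≠ q := by
    intro h; rw [h] at hdist
    have := Finset.card_le_three (a := p) (b := q) (c := q + 1)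
    simp at hdist; omega
  have d5 : q + 1 ≠ q := fun h => d1 (by simpa using h.symm)
  have hq1 : f (q + 1) = p := by rw [← hp, hinv]
  have hq : f q = p + 1 := by rw [← hp1, hinv]
  have main : ∀ D ∈ chords f, D ≠ ({p, q + 1} : Finset (ZMod (2 * n))) →
      D ≠ ({p + 1, q} : Finset (ZMod (2 * n))) →
      (linkedPair D ({p, q + 1} : Finset (ZMod (2 * n))) ↔
        linkedPair D ({p + 1, q} : Finset (ZMod (2 * n)))) := by
    rintro D ⟨x, rfl⟩ h1 h2
    have n1 : p ∉ ({x, f x} : Finset (ZMod (2 * n))) := by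
      intro h
      rcases Finset.mem_insert.1 h with rfl | h
      · exact h1 (by rw [hp])
      · have h := Finset.mem_singleton.1 h
        have : x = q + 1 := by rw [← hp, h, hinv]
        subst this
        exact h1 (by rw [hq1, Finset.pair_comm])
    have n2 : q + 1 ∉ ({x, f x} : Finset (ZMod (2 * n))) := by
      intro h
      rcases Finset.mem_insert.1 h with rfl | h
      · exact h1 (by rw [hq1, Finset.pair_comm])
      · have h := Finset.mem_singleton.1 h
        have : x = p := by rw [← hq1, h, hinv]
        subst this
        exact h1 (by rw [hp])
    have n3 : p + 1 ∉ ({x, f x} : Finset (ZMod (2 * n))) := by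
      intro h
      rcases Finset.mem_insert.1 h with rfl | h
      · exact h2 (by rw [hp1])
      · have h := Finset.mem_singleton.1 h
        have : x = q := by rw [← hp1, h, hinv]
        subst this
        exact h2 (by rw [hq, Finset.pair_comm])
    have n4 : q ∉ ({x, f x} : Finset (ZMod (2 * n))) := by
      intro h
      rcases Finset.mem_insert.1 h with rfl | h
      · exact h2 (by rw [hq, Finset.pair_comm])
      · have h := Finset.mem_singleton.1 h
        have : x = p + 1 := by rw [← hq, h, hinv]
        subst this
        exact h2 (by rw [hp1])
    rw [linkedPair_iff, linkedPair_iff]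
    refine exists_congr fun a => exists_congr fun b => and_congr_right fun h => ?_
    rw [h] at n1 n2 n3 n4
    simp only [Finset.mem_insert, Finset.mem_singleton, not_or] at n1 n2 n3 n4
    unfold linked
    rw [arc_step a b p n1.1 n3.2 n3.1 n1.2, arc_step a b q n4.1 n2.2 n2.1 n4.2]
  refine ⟨main, ?_⟩
  have hs : {D ∈ chords f | linkedPair D ({p, q + 1} : Finset (ZMod (2 * n)))} =
      {D ∈ chords f | linkedPair D ({p + 1, q} : Finset (ZMod (2 * n)))} := by
    ext D
    simp only [Set.mem_setOf_eq]
    refine and_congr_right fun hD => ?_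
    by_cases h1 : D = {p, q + 1}
    · subst h1
      exact iff_of_false (not_linked_self _ _) (not_linked_nested p q d3 d4 d2 d1.symm)
    by_cases h2 : D = {p + 1, q}
    · subst h2
      refine iff_of_false ?_ (not_linked_self _ _)
      have := not_linked_nested q p d4 d3 d2.symm d5
      rwa [Finset.pair_comm q, Finset.pair_comm (q + 1)] at this
    exact main D hD h1 h2
  rw [hs]
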